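/- Let 𝒥 ⊆ ℝ² be a self-similar set satisfying the Open Set Condition and not contained in a line. Then there exist constants κ > 0 and C ≥ 1, independent of δ and ρ, such that for every line ℓ ⊆ ℝ² and all δ, ρ with 0 < δ < ρ ≤ 1, the two-dimensional Lebesgue measure satisfies |𝒥^δ ∩ ℓ^ρ| ≤ C ρ^κ |𝒥^δ|, where ℓ^ρ is the ρ-neighborhood of ℓ. -/

import Mathlib

open MeasureTheory Metric Set

/-- A line in the plane. -/
def IsLine (ℓ : Set ℂ) : Prop := ∃ p v : ℂ, v ≠ 0 ∧ ℓ = {w : ℂ | ∃ t : ℝ, w = p + t • v}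

noncomputable section

namespace SS

/-- the similarity map -/
def TT (l : ℝ) (R : ℂ ≃ₗᵢ[ℝ] ℂ) (z x : ℂ) : ℂ := l • R x + z

lemma TT_dist (l : ℝ) (hl : 0 < l) (R : ℂ ≃ₗᵢ[ℝ] ℂ) (z x y : ℂ) :
    dist (TT l R z x) (TT l R z y) = l * dist x y := by
  unfold TT
  rw [dist_add_right, dist_smul₀, R.dist_map, Real.norm_of_nonneg hl.le]

lemma TT_surj (l : ℝ) (hl : 0 < l) (R : ℂ ≃ₗᵢ[ℝ] ℂ) (z x : ℂ) : ∃ y, TT l R z y = x := by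
  refine ⟨R.symm (l⁻¹ • (x - z)), ?_⟩
  unfold TT
  rw [R.apply_symm_apply, smul_inv_smul₀ hl.ne']
  ring

lemma TT_inj (l : ℝ) (hl : 0 < l) (R : ℂ ≃ₗᵢ[ℝ] ℂ) (z : ℂ) : Function.Injective (TT l R z) := by
  intro x y h
  have := TT_dist l hl R z x y
  rw [h, dist_self] at this
  have h2 : dist x y = 0 := by
    rcases mul_eq_zero.1 this.symm with h | h
    · exact absurd h hl.ne'
    · exact h
  exact dist_eq_zero.1 h2

lemma TT_cont (l : ℝ) (R : ℂ ≃ₗᵢ[ℝ] ℂ) (z : ℂ) : Continuous (TT l R z) := by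
  unfold TT
  have := R.continuous
  fun_prop

open scoped Pointwise in
lemma TT_vol (l : ℝ) (hl : 0 < l) (R : ℂ ≃ₗᵢ[ℝ] ℂ) (z : ℂ) (A : Set ℂ) :
    volume.real (TT l R z '' A) = l ^ 2 * volume.real A := by
  have h1 : TT l R z '' A = (fun x => z + x) '' (l • (R '' A)) := by
    rw [← image_smul, image_image, image_image]
    apply image_congr
    intro x _
    simp only [TT]
    ring
  have h2 : volume (R '' A) = volume A := by
    have h3 : R '' A = R.symm ⁻¹' A := by
      rw [LinearIsometryEquiv.image_eq_preimage_symm]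
    have h4 := R.symm.measurePreserving
    have h5 : MeasurePreserving (R.symm.toMeasurableEquiv) volume volume := h4
    rw [h3]
    exact h5.measure_preimage_equiv A
  rw [Measure.real, Measure.real, h1, image_add_left, measure_preimage_add, Measure.addHaar_smul, h2,
    ENNReal.toReal_mul, ENNReal.toReal_ofReal (abs_nonneg _), Complex.finrank_real_complex,
    abs_of_nonneg (by positivity)]

lemma mem_cth {J : Set ℂ} (hJ : IsCompact J) {δ : ℝ} (hδ : 0 < δ) (x : ℂ) :
    x ∈ cthickening δ J ↔ ∃ y ∈ J, dist x y ≤ δ := by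
  rw [hJ.cthickening_eq_biUnion_closedBall hδ.le]
  simp

lemma cth_fin {J : Set ℂ} (hJ : IsCompact J) (δ : ℝ) : volume (cthickening δ J) ≠ ⊤ :=
  hJ.isBounded.cthickening.measure_lt_top.ne

/-- scale induction -/
lemma scale_ind (P : ℝ → Prop) (a M r : ℝ) (ha : 0 < a) (hr0 : 0 < r) (hr : r < 1)
    (base : ∀ x, a < x → x ≤ M → P x)
    (step : ∀ x, 0 < x → x ≤ a → (∀ y, x / r ≤ y → y ≤ M → P y) → P x) :
    ∀ x, 0 < x → x ≤ M → P x := by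
  have key : ∀ k : ℕ, ∀ x, a * r ^ k < x → x ≤ M → P x := by
    intro k
    induction k with
    | zero => intro x hx; exact base x (by simpa using hx)
    | succ k ih =>
      intro x hx hM
      have hpos : 0 < a * r ^ (k+1) := by positivity
      by_cases h : a < x
      · exact base x h hM
      · refine step x (hpos.trans hx) (not_lt.1 h) ?_
        intro y hy hyM
        refine ih y (lt_of_lt_of_le ?_ hy) hyM
        rw [lt_div_iff₀ hr0]
        calc _ = a * r ^ (k+1) := by ring
          _ < x := hx
  intro x hx hM
  obtain ⟨k, hk⟩ := exists_pow_lt_of_lt_one (div_pos hx ha) hr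
  refine key k x ?_ hM
  rw [lt_div_iff₀ ha] at hk
  linarith

/-- iterated function system data -/
structure IFS (ι : Type) [Fintype ι] (lam : ι → ℝ) (rot : ι → ℂ ≃ₗᵢ[ℝ] ℂ) (z : ι → ℂ)
    (J : Set ℂ) (d : ℝ) : Prop where
  pos : ∀ i, 0 < lam i
  lt : ∀ i, lam i < 1
  self : J = ⋃ i, TT (lam i) (rot i) (z i) '' J
  sum : ∑ i, lam i ^ d = 1

lemma IFS.bounds {ι : Type} [Fintype ι] {lam : ι → ℝ} {rot : ι → ℂ ≃ₗᵢ[ℝ] ℂ} {z : ι → ℂ}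
    {J : Set ℂ} {d : ℝ} (H : IFS ι lam rot z J d) :
    ∃ q r : ℝ, 0 < q ∧ 0 < r ∧ r < 1 ∧ ∀ i, q ≤ lam i ∧ lam i ≤ r := by
  have hne : Nonempty ι := by
    by_contra h
    rw [not_nonempty_iff] at h
    have := H.sum
    simp at this
  obtain ⟨i0, h0⟩ := Finite.exists_min lam
  obtain ⟨i1, h1⟩ := Finite.exists_max lam
  exact ⟨lam i0, lam i1, H.pos _, H.pos _, H.lt _, fun i => ⟨h0 i, h1 i⟩⟩

lemma IFS.comp {ι ι' : Type} [Fintype ι] [Fintype ι'] {lam : ι → ℝ} {rot : ι → ℂ ≃ₗᵢ[ℝ] ℂ}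
    {z : ι → ℂ} {lam' : ι' → ℝ} {rot' : ι' → ℂ ≃ₗᵢ[ℝ] ℂ}
    {z' : ι' → ℂ} {J : Set ℂ} {d : ℝ} (H : IFS ι lam rot z J d) (H' : IFS ι' lam' rot' z' J d) :
    IFS (ι × ι') (fun p => lam p.1 * lam' p.2) (fun p => (rot' p.2).trans (rot p.1))
      (fun p => TT (lam p.1) (rot p.1) (z p.1) (z' p.2)) J d where
  pos p := mul_pos (H.pos _) (H'.pos _)
  lt p := by
    have := H.pos p.1; have := H'.pos p.2; have := H.lt p.1; have := H'.lt p.2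
    nlinarith
  self := by
    have e : ∀ p : ι × ι', TT (lam p.1 * lam' p.2) ((rot' p.2).trans (rot p.1))
      (TT (lam p.1) (rot p.1) (z p.1) (z' p.2)) '' J =
      TT (lam p.1) (rot p.1) (z p.1) '' (TT (lam' p.2) (rot' p.2) (z' p.2) '' J) := by
      intro p
      rw [image_image]
      apply image_congr
      intro x _
      simp only [TT, LinearIsometryEquiv.trans_apply, map_add, map_smul, smul_add, mul_smul]
      ring
    simp only [e]
    rw [iUnion_prod']
    simp only [← image_iUnion]
    rw [← H'.self, ← H.self]
  sum := by
    rw [Fintype.sum_prod_type]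
    have : ∀ i j, (lam i * lam' j) ^ d = lam i ^ d * lam' j ^ d := fun i j =>
      Real.mul_rpow (H.pos i).le (H'.pos j).le
    simp only [this, ← Finset.mul_sum, H'.sum, H.sum, mul_one]

lemma IFS.iter {ι : Type} [Fintype ι] {lam : ι → ℝ} {rot : ι → ℂ ≃ₗᵢ[ℝ] ℂ} {z : ι → ℂ}
    {J : Set ℂ} {d : ℝ} (H : IFS ι lam rot z J d) (r : ℝ) (hr : ∀ i, lam i ≤ r) (hr0 : 0 < r)
    (n : ℕ) :
    ∃ (ι' : Type) (_ : Fintype ι') (lam' : ι' → ℝ) (rot' : ι' → ℂ ≃ₗᵢ[ℝ] ℂ) (z' : ι' → ℂ),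
      IFS ι' lam' rot' z' J d ∧ ∀ i, lam' i ≤ r ^ (n + 1) := by
  induction n with
  | zero => exact ⟨ι, _, lam, rot, z, H, by simpa using hr⟩
  | succ n ih =>
    obtain ⟨ι', _, lam', rot', z', H', h'⟩ := ih
    refine ⟨_, _, _, _, _, H.comp H', ?_⟩
    rintro ⟨i, j⟩
    rw [pow_succ' r (n+1)]
    exact mul_le_mul (hr i) (h' j) (H'.pos j).le hr0.le

lemma cth_cover {ι : Type} [Fintype ι] {lam : ι → ℝ} {rot : ι → ℂ ≃ₗᵢ[ℝ] ℂ} {z : ι → ℂ}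
    {J : Set ℂ} {d : ℝ} (hJ : IsCompact J) (H : IFS ι lam rot z J d) {δ : ℝ} (hδ : 0 < δ) {x : ℂ}
    (hx : x ∈ cthickening δ J) :
    ∃ i, ∃ w ∈ cthickening (δ / lam i) J, ∃ u ∈ J,
      TT (lam i) (rot i) (z i) w = x ∧ dist x (TT (lam i) (rot i) (z i) u) ≤ δ := by
  obtain ⟨y, hy, hxy⟩ := (mem_cth hJ hδ x).1 hx
  rw [H.self] at hy
  obtain ⟨i, u, hu, rfl⟩ := mem_iUnion.1 hy
  obtain ⟨w, rfl⟩ := TT_surj (lam i) (H.pos i) (rot i) (z i) x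
  refine ⟨i, w, (mem_cth hJ (div_pos hδ (H.pos i)) w).2 ⟨u, hu, ?_⟩, u, hu, rfl, hxy⟩
  rw [TT_dist _ (H.pos i)] at hxy
  rw [le_div_iff₀ (H.pos i)]
  linarith

lemma cth_image {ι : Type} [Fintype ι] {lam : ι → ℝ} {rot : ι → ℂ ≃ₗᵢ[ℝ] ℂ} {z : ι → ℂ}
    {J : Set ℂ} {d : ℝ} (hJ : IsCompact J) (H : IFS ι lam rot z J d) {δ : ℝ} (hδ : 0 < δ) (i : ι) :
    TT (lam i) (rot i) (z i) '' (cthickening (δ / lam i) J) ⊆ cthickening δ J := by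
  rintro _ ⟨w, hw, rfl⟩
  obtain ⟨u, hu, h⟩ := (mem_cth hJ (div_pos hδ (H.pos i)) w).1 hw
  refine (mem_cth hJ hδ _).2 ⟨TT (lam i) (rot i) (z i) u, ?_, ?_⟩
  · rw [H.self]; exact mem_iUnion.2 ⟨i, u, hu, rfl⟩
  · rw [TT_dist _ (H.pos i)]
    rw [le_div_iff₀ (H.pos i)] at h
    linarith

lemma scale_id {l d x C : ℝ} (hl : 0 < l) (hx : 0 < x) :
    l ^ 2 * (C * (x / l) ^ (2 - d)) = C * x ^ (2 - d) * l ^ d := by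
  rw [Real.div_rpow hx.le hl.le, Real.rpow_sub hl]
  have := (Real.rpow_pos_of_pos hl d).ne'
  have := (Real.rpow_pos_of_pos hl 2).ne'
  have h2 : l ^ (2:ℝ) = l ^ 2 := Real.rpow_two l
  rw [h2] at *
  field_simp

/-- a continuous positive function bound -/
lemma rpow_bdd (e a M : ℝ) (ha : 0 < a) : ∃ m B : ℝ, 0 < m ∧ 0 < B ∧
    ∀ x, a ≤ x → x ≤ M → m ≤ x ^ e ∧ x ^ e ≤ B := by
  by_cases haM : a ≤ M
  · have hM := ha.trans_le haM
    refine ⟨min (a ^ e) (M ^ e), max (a ^ e) (M ^ e), by positivity, by positivity, ?_⟩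
    intro x h1 h2
    have hx := ha.trans_le h1
    rcases le_total 0 e with he | he
    · exact ⟨(min_le_left _ _).trans (Real.rpow_le_rpow ha.le h1 he),
        (Real.rpow_le_rpow hx.le h2 he).trans (le_max_right _ _)⟩
    · exact ⟨(min_le_right _ _).trans (Real.rpow_le_rpow_of_nonpos hx h2 he),
        (Real.rpow_le_rpow_of_nonpos ha h1 he).trans (le_max_left _ _)⟩
  · exact ⟨1, 1, one_pos, one_pos, fun x h1 h2 => absurd (h1.trans h2) haM⟩

lemma upper_V {ι : Type} [Fintype ι] {lam : ι → ℝ} {rot : ι → ℂ ≃ₗᵢ[ℝ] ℂ} {z : ι → ℂ}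
    {J : Set ℂ} {d : ℝ} (hJ : IsCompact J) (H : IFS ι lam rot z J d) (M : ℝ) (hM : 0 < M) :
    ∃ C : ℝ, 0 < C ∧ ∀ δ, 0 < δ → δ ≤ M → volume.real (cthickening δ J) ≤ C * δ ^ (2 - d) := by
  obtain ⟨q, r, hq, hr0, hr, hb⟩ := H.bounds
  obtain ⟨m, B, hm, hB, hmB⟩ := rpow_bdd (2 - d) (q * M) M (by positivity)
  set C := (volume.real (cthickening M J) + 1) / m with hC
  have hV : 0 ≤ volume.real (cthickening M J) := measureReal_nonneg
  have hC0 : 0 < C := by positivity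
  refine ⟨C, hC0, ?_⟩
  refine scale_ind _ (q * M) M r (by positivity) hr0 hr ?_ ?_
  · intro x hx hxM
    have h1 : volume.real (cthickening x J) ≤ volume.real (cthickening M J) :=
      measureReal_mono (cthickening_mono hxM J) (cth_fin hJ M)
    have h2 := (hmB x hx.le hxM).1
    calc _ ≤ volume.real (cthickening M J) + 1 := by linarith
      _ = C * m := by rw [hC]; field_simp
      _ ≤ _ := by gcongr
  · intro x hx hxq ih
    have h1 : cthickening x J ⊆ ⋃ i, TT (lam i) (rot i) (z i) '' (cthickening (x / lam i) J) := by
      intro y hy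
      obtain ⟨i, w, hw, u, hu, h, _⟩ := cth_cover hJ H hx hy
      exact mem_iUnion.2 ⟨i, w, hw, h⟩
    have hfin : volume (⋃ i, TT (lam i) (rot i) (z i) '' (cthickening (x / lam i) J)) ≠ ⊤ := by
      refine ((measure_mono (iUnion_subset fun i => cth_image hJ H hx i)).trans_lt
        (cth_fin hJ x).lt_top).ne
    calc _ ≤ _ := measureReal_mono h1 hfin
      _ ≤ _ := measureReal_iUnion_fintype_le _
      _ ≤ ∑ i, C * x ^ (2 - d) * lam i ^ d := by
        apply Finset.sum_le_sum
        intro i _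
        have hp := H.pos i
        rw [TT_vol _ hp, ← scale_id hp hx]
        gcongr
        apply ih
        · gcongr; exact (hb i).2
        · rw [div_le_iff₀ hp]
          have := (hb i).1
          nlinarith
      _ = _ := by rw [← Finset.mul_sum, H.sum, mul_one]

lemma lower_V {ι : Type} [Fintype ι] {lam : ι → ℝ} {rot : ι → ℂ ≃ₗᵢ[ℝ] ℂ} {z : ι → ℂ}
    {J : Set ℂ} {d : ℝ} (hJ : IsCompact J) (hJne : J.Nonempty) (H : IFS ι lam rot z J d)
    (U : Set ℂ) (hU : IsOpen U) (hUne : U.Nonempty)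
    (hsub : ∀ i, TT (lam i) (rot i) (z i) '' U ⊆ U)
    (hdis : ∀ i j, i ≠ j →
      Disjoint (TT (lam i) (rot i) (z i) '' U) (TT (lam j) (rot j) (z j) '' U)) :
    ∃ c : ℝ, 0 < c ∧ ∀ δ, 0 < δ → δ ≤ 1 → c * δ ^ (2 - d) ≤ volume.real (cthickening δ J) := by
  obtain ⟨q, r, hq, hr0, hr, hb⟩ := H.bounds
  obtain ⟨x0, hx0⟩ := hUne
  obtain ⟨y0, hy0⟩ := hJne
  set K := dist x0 y0 + 1 with hK
  have hK1 : 1 ≤ K := by have := dist_nonneg (x := x0) (y := y0); linarith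
  have hK0 : 0 < K := by linarith
  have hfin : ∀ δ, volume (cthickening δ J ∩ U) ≠ ⊤ := fun δ =>
    ((measure_mono inter_subset_left).trans_lt (cth_fin hJ δ).lt_top).ne
  have hpos : 0 < volume.real (cthickening K J ∩ U) := by
    refine ENNReal.toReal_pos ?_ (hfin K)
    have hopen : IsOpen (ball y0 K ∩ U) := isOpen_ball.inter hU
    have hne : (ball y0 K ∩ U).Nonempty := ⟨x0, by simp [hK], hx0⟩
    refine ((hopen.measure_pos volume hne).trans_le (measure_mono ?_)).ne'
    rintro x ⟨hx, hxU⟩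
    exact ⟨(mem_cth hJ hK0 x).2 ⟨y0, hy0, (mem_ball.1 hx).le⟩, hxU⟩
  obtain ⟨m, B, hm, hB, hmB⟩ := rpow_bdd (2 - d) K (K / q) hK0
  set c := volume.real (cthickening K J ∩ U) / B with hc
  have hc0 : 0 < c := by positivity
  have hq1 : q < 1 := by
    obtain ⟨i⟩ : Nonempty ι := by
      by_contra h
      rw [not_nonempty_iff] at h
      have := H.sum
      simp at this
    exact (hb i).1.trans_lt (H.lt i)
  have hKq : K ≤ K / q := by rw [le_div_iff₀ hq]; nlinarith
  suffices h : ∀ δ, 0 < δ → δ ≤ K / q → c * δ ^ (2 - d) ≤ volume.real (cthickening δ J ∩ U) by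
    refine ⟨c, hc0, fun δ h0 h1 => (h δ h0 (by linarith)).trans ?_⟩
    exact measureReal_mono inter_subset_left (cth_fin hJ δ)
  refine scale_ind _ K (K / q) r hK0 hr0 hr ?_ ?_
  · intro x hx hxM
    have h2 := (hmB x hx.le hxM).2
    calc c * x ^ (2 - d) ≤ c * B := by gcongr
      _ = volume.real (cthickening K J ∩ U) := by rw [hc]; field_simp
      _ ≤ _ := measureReal_mono (inter_subset_inter_left _ (cthickening_mono hx.le J)) (hfin x)
  · intro x hx hxq ih
    have hsub2 : ∀ i, TT (lam i) (rot i) (z i) '' (cthickening (x / lam i) J ∩ U) ⊆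
        cthickening x J ∩ U := fun i => subset_inter
      ((image_mono inter_subset_left).trans (cth_image hJ H hx i))
      ((image_mono inter_subset_right).trans (hsub i))
    calc c * x ^ (2 - d) = ∑ i, c * x ^ (2 - d) * lam i ^ d := by
          rw [← Finset.mul_sum, H.sum, mul_one]
      _ ≤ ∑ i, volume.real (TT (lam i) (rot i) (z i) '' (cthickening (x / lam i) J ∩ U)) := by
        apply Finset.sum_le_sum
        intro i _
        have hp := H.pos i
        rw [TT_vol _ hp, ← scale_id hp hx]
        gcongr
        apply ih
        · gcongr; exact (hb i).2
        · have := (hb i).1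
          gcongr
      _ = volume.real (⋃ i, TT (lam i) (rot i) (z i) '' (cthickening (x / lam i) J ∩ U)) := by
        symm
        apply measureReal_iUnion_fintype
        · intro i j hij
          exact (hdis i j hij).mono (image_mono inter_subset_right) (image_mono inter_subset_right)
        · intro i
          exact (isClosed_cthickening.measurableSet.inter hU.measurableSet).image_of_continuousOn_injOn
            (TT_cont _ _ _).continuousOn (TT_inj _ (H.pos i) _ _).injOn
        · intro i
          exact ((measure_mono (hsub2 i)).trans_lt (hfin x).lt_top).ne
      _ ≤ _ := measureReal_mono (iUnion_subset hsub2) (hfin x)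

lemma exists_kappa {ι : Type} [Fintype ι] [DecidableEq ι] {lam : ι → ℝ} {d : ℝ}
    (hpos : ∀ i, 0 < lam i) (hsum : ∑ i, lam i ^ d = 1) :
    ∃ κ : ℝ, 0 < κ ∧ ∀ j, ∑ i ∈ Finset.univ.erase j, lam i ^ (d - κ) ≤ 1 := by
  have h : ∀ j, ∀ᶠ κ in nhds (0:ℝ), ∑ i ∈ Finset.univ.erase j, lam i ^ (d - κ) < 1 := by
    intro j
    have hc : Continuous (fun κ : ℝ => ∑ i ∈ Finset.univ.erase j, lam i ^ (d - κ)) := by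
      apply continuous_finset_sum
      intro i _
      exact (Real.continuous_const_rpow (hpos i).ne').comp (by fun_prop)
    refine hc.continuousAt.eventually_lt continuousAt_const ?_
    simp only [sub_zero]
    have := Finset.add_sum_erase Finset.univ (fun i => lam i ^ d) (Finset.mem_univ j)
    have h2 := Real.rpow_pos_of_pos (hpos j) d
    linarith
  have h2 := Filter.eventually_all.2 h
  obtain ⟨ε, hε, h3⟩ := Metric.eventually_nhds_iff.1 h2
  refine ⟨ε / 2, by positivity, fun j => (h3 ?_ j).le⟩
  rw [Real.dist_eq, sub_zero, abs_of_pos (by positivity)]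
  linarith

/-- strip -/
def strip (n : ℂ) (t ρ : ℝ) : Set ℂ := {x | |inner ℝ n x - t| ≤ ρ}

lemma strip_pull {l : ℝ} (hl : 0 < l) (R : ℂ ≃ₗᵢ[ℝ] ℂ) (z n w : ℂ) (t ρ : ℝ)
    (h : TT l R z w ∈ strip n t ρ) :
    w ∈ strip (R.symm n) ((t - inner ℝ n z) / l) (ρ / l) := by
  simp only [strip, mem_setOf_eq, TT, inner_add_right, inner_smul_right] at h ⊢
  have e : inner ℝ (R.symm n) w = inner ℝ n (R w) := by
    rw [← R.inner_map_map, R.apply_symm_apply]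
  rw [e, le_div_iff₀ hl]
  calc _ = |(inner ℝ n (R w) - (t - inner ℝ n z) / l) * l| := by rw [abs_mul, abs_of_pos hl]
    _ = |l * inner ℝ n (R w) + inner ℝ n z - t| := by
      congr 1; field_simp; ring
    _ ≤ ρ := h

lemma scale_id2 {l d κ x y C : ℝ} (hl : 0 < l) (hx : 0 < x) (hy : 0 < y) :
    l ^ 2 * (C * (x / l) ^ (2 - d) * (y / l) ^ κ) = C * x ^ (2 - d) * y ^ κ * l ^ (d - κ) := by
  rw [Real.div_rpow hx.le hl.le, Real.div_rpow hy.le hl.le, Real.rpow_sub hl, Real.rpow_sub hl]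
  have := (Real.rpow_pos_of_pos hl d).ne'
  have := (Real.rpow_pos_of_pos hl κ).ne'
  rw [Real.rpow_two l]
  field_simp

lemma upper_F {ι : Type} [Fintype ι] {lam : ι → ℝ} {rot : ι → ℂ ≃ₗᵢ[ℝ] ℂ} {z : ι → ℂ}
    {J : Set ℂ} {d : ℝ} (hJ : IsCompact J) (H : IFS ι lam rot z J d) (ρ0 : ℝ) (hρ0 : 0 < ρ0)
    (hmiss : ∀ (n : ℂ) (t : ℝ), ‖n‖ = 1 → ∃ j, ∀ u ∈ J, ∀ x,
      dist x (TT (lam j) (rot j) (z j) u) ≤ ρ0 → x ∉ strip n t ρ0) :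
    ∃ κ C : ℝ, 0 < κ ∧ 0 < C ∧ ∀ ρ, 0 < ρ → ρ ≤ 1 → ∀ δ n t, 0 < δ → δ ≤ ρ → ‖n‖ = 1 →
      volume.real (cthickening δ J ∩ strip n t ρ) ≤ C * δ ^ (2 - d) * ρ ^ κ := by
  classical
  obtain ⟨q, r, hq, hr0, hr, hb⟩ := H.bounds
  obtain ⟨κ, hκ, hsum⟩ := exists_kappa H.pos H.sum
  set M := max (ρ0 / q) 1 with hMdef
  have hM : 0 < M := by positivity
  obtain ⟨C1, hC1, hV⟩ := upper_V hJ H M hM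
  obtain ⟨m, B, hm, hB, hmB⟩ := rpow_bdd κ ρ0 M hρ0
  set C := C1 / m with hC
  have hC0 : 0 < C := by positivity
  refine ⟨κ, C, hκ, hC0, ?_⟩
  suffices h : ∀ ρ, 0 < ρ → ρ ≤ M → ∀ δ n t, 0 < δ → δ ≤ ρ → ‖n‖ = 1 →
      volume.real (cthickening δ J ∩ strip n t ρ) ≤ C * δ ^ (2 - d) * ρ ^ κ from
    fun ρ h0 h1 => h ρ h0 (h1.trans (le_max_right _ _))
  refine scale_ind _ ρ0 M r hρ0 hr0 hr ?_ ?_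
  · intro ρ hρ hρM δ n t hδ hδρ hn
    have h2 := (hmB ρ hρ.le hρM).1
    have h3 : 0 < δ ^ (2 - d) := Real.rpow_pos_of_pos hδ _
    calc _ ≤ volume.real (cthickening δ J) := measureReal_mono inter_subset_left (cth_fin hJ δ)
      _ ≤ C1 * δ ^ (2 - d) := hV δ hδ (hδρ.trans hρM)
      _ = C * δ ^ (2 - d) * m := by rw [hC]; field_simp
      _ ≤ _ := by gcongr
  · intro ρ hρ hρρ0 ih δ n t hδ hδρ hn
    obtain ⟨j, hj⟩ := hmiss n t hn
    set A : ι → Set ℂ := fun i => TT (lam i) (rot i) (z i) '' (cthickening (δ / lam i) J ∩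
      strip ((rot i).symm n) ((t - inner ℝ n (z i)) / lam i) (ρ / lam i)) with hA
    have h1 : cthickening δ J ∩ strip n t ρ ⊆ ⋃ i ∈ Finset.univ.erase j, A i := by
      rintro y ⟨hy, hys⟩
      obtain ⟨i, w, hw, u, hu, h, hd⟩ := cth_cover hJ H hδ hy
      have hij : i ≠ j := by
        rintro rfl
        refine hj u hu y (hd.trans (hδρ.trans hρρ0)) ?_
        exact le_trans hys hρρ0
      refine mem_iUnion₂.2 ⟨i, by simp [hij], w, ⟨hw, ?_⟩, h⟩
      apply strip_pull (H.pos i)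
      rw [h]; exact hys
    have hfin : volume (⋃ i ∈ Finset.univ.erase j, A i) ≠ ⊤ := by
      refine ((measure_mono (iUnion₂_subset fun i _ => ?_)).trans_lt
        (cth_fin hJ δ).lt_top).ne
      exact (image_mono inter_subset_left).trans (cth_image hJ H hδ i)
    calc _ ≤ _ := measureReal_mono h1 hfin
      _ ≤ _ := measureReal_biUnion_finset_le _ _
      _ ≤ ∑ i ∈ Finset.univ.erase j, C * δ ^ (2 - d) * ρ ^ κ * lam i ^ (d - κ) := by
        apply Finset.sum_le_sum
        intro i _
        have hp := H.pos i
        simp only [hA]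
        rw [TT_vol _ hp, ← scale_id2 hp hδ hρ]
        gcongr
        apply ih
        · gcongr; exact (hb i).2
        · refine le_trans ?_ (le_max_left _ _)
          have := (hb i).1
          gcongr
        · positivity
        · gcongr
        · simpa using hn
      _ ≤ _ := by
        rw [← Finset.mul_sum]
        have : 0 < C * δ ^ (2 - d) * ρ ^ κ := by positivity
        have := hsum j
        nlinarith

lemma noncol {J : Set ℂ} (hJne : J.Nonempty) (hline : ¬ Collinear ℝ J) :
    ∃ ε : ℝ, 0 < ε ∧ ∀ (n : ℂ) (t : ℝ), ‖n‖ = 1 → ∃ a ∈ J, ε < |inner ℝ n a - t| := by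
  obtain ⟨a, ha⟩ := hJne
  have h1 : ∃ b ∈ J, ∃ c ∈ J,
      (b - a).re * (c - a).im - (b - a).im * (c - a).re ≠ 0 := by
    by_contra! hcon
    apply hline
    rw [collinear_iff_of_mem ha]
    by_cases hb : ∃ b ∈ J, b ≠ a
    · obtain ⟨b, hb, hba⟩ := hb
      refine ⟨b - a, fun c hc => ?_⟩
      have h := hcon b hb c hc
      have hne : (b - a).re ≠ 0 ∨ (b - a).im ≠ 0 := by
        by_contra! h
        exact hba (sub_eq_zero.1 (Complex.ext h.1 h.2))
      rcases hne with h' | h'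
      · refine ⟨(c - a).re / (b - a).re, ?_⟩
        rw [vadd_eq_add, ← sub_eq_iff_eq_add]
        apply Complex.ext
        · rw [Complex.smul_re, smul_eq_mul]; field_simp
        · rw [Complex.smul_im, smul_eq_mul]; field_simp; linarith
      · refine ⟨(c - a).im / (b - a).im, ?_⟩
        rw [vadd_eq_add, ← sub_eq_iff_eq_add]
        apply Complex.ext
        · rw [Complex.smul_re, smul_eq_mul]; field_simp; linarith
        · rw [Complex.smul_im, smul_eq_mul]; field_simp
    · push Not at hb
      exact ⟨0, fun p hp => ⟨0, by simp [hb p hp]⟩⟩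
  obtain ⟨b, hb, c, hc, hD⟩ := h1
  set D := (b - a).re * (c - a).im - (b - a).im * (c - a).re with hDdef
  set S := |(b - a).re| + |(b - a).im| + |(c - a).re| + |(c - a).im| + 1 with hS
  have hS0 : 0 < S := by positivity
  have hD0 : 0 < |D| := abs_pos.2 hD
  refine ⟨|D| / (8 * S), by positivity, ?_⟩
  intro n t hn
  by_contra! hcon
  set ε := |D| / (8 * S) with hε
  have hεD : ε * (8 * S) = |D| := by rw [hε]; field_simp
  have hε0 : 0 < ε := by positivity
  have hB : |inner ℝ n (b - a)| ≤ 2 * ε := by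
    have h1 := hcon a ha; have h2 := hcon b hb
    rw [inner_sub_right]
    rw [abs_le] at *
    constructor <;> linarith
  have hC : |inner ℝ n (c - a)| ≤ 2 * ε := by
    have h1 := hcon a ha; have h2 := hcon c hc
    rw [inner_sub_right]
    rw [abs_le] at *
    constructor <;> linarith
  set p := inner ℝ n (b - a) with hp
  set s := inner ℝ n (c - a) with hs
  have ep : p = (b - a).re * n.re + (b - a).im * n.im := by
    rw [hp, Complex.inner]; simp
  have es : s = (c - a).re * n.re + (c - a).im * n.im := by
    rw [hs, Complex.inner]; simp
  have e1 : D * n.re = p * (c - a).im - s * (b - a).im := by rw [ep, es, hDdef]; ring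
  have e2 : D * n.im = s * (b - a).re - p * (c - a).re := by rw [ep, es, hDdef]; ring
  have f1 : |D| * |n.re| ≤ 2 * ε * |(c - a).im| + 2 * ε * |(b - a).im| := by
    rw [← abs_mul, e1]
    refine (abs_sub _ _).trans ?_
    rw [abs_mul, abs_mul]
    gcongr
  have f2 : |D| * |n.im| ≤ 2 * ε * |(b - a).re| + 2 * ε * |(c - a).re| := by
    rw [← abs_mul, e2]
    refine (abs_sub _ _).trans ?_
    rw [abs_mul, abs_mul]
    gcongr
  have f3 : 1 ≤ |n.re| + |n.im| := hn ▸ Complex.norm_le_abs_re_add_abs_im n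
  have f4 : |D| ≤ |D| * |n.re| + |D| * |n.im| := by nlinarith
  have f5 : |D| ≤ 2 * ε * S := by
    rw [hS]; linarith
  nlinarith

lemma inner_lip {n : ℂ} (hn : ‖n‖ = 1) (x y : ℂ) : |inner ℝ n x - inner ℝ n y| ≤ dist x y := by
  rw [← inner_sub_right, dist_eq_norm]
  have := abs_real_inner_le_norm n (x - y)
  rwa [hn, one_mul] at this

lemma upper_all {ι : Type} [Fintype ι] {lam : ι → ℝ} {rot : ι → ℂ ≃ₗᵢ[ℝ] ℂ} {z : ι → ℂ}
    {J : Set ℂ} {d : ℝ} (hJ : IsCompact J) (hJne : J.Nonempty) (hline : ¬ Collinear ℝ J)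
    (H : IFS ι lam rot z J d) :
    ∃ κ C : ℝ, 0 < κ ∧ 0 < C ∧ ∀ ρ, 0 < ρ → ρ ≤ 1 → ∀ δ n t, 0 < δ → δ ≤ ρ → ‖n‖ = 1 →
      volume.real (cthickening δ J ∩ strip n t ρ) ≤ C * δ ^ (2 - d) * ρ ^ κ := by
  obtain ⟨ε, hε, hfar⟩ := noncol hJne hline
  obtain ⟨q, r, hq, hr0, hr, hb⟩ := H.bounds
  have hdiam : 0 ≤ diam J := diam_nonneg
  obtain ⟨k, hk⟩ := exists_pow_lt_of_lt_one (show 0 < ε / 4 / (diam J + 1) by positivity) hr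
  obtain ⟨ι', _, lam', rot', z', H', h'⟩ := H.iter r (fun i => (hb i).2) hr0 k
  refine upper_F hJ H' (ε / 4) (by positivity) ?_
  intro n t hn
  obtain ⟨a, ha, hat⟩ := hfar n t hn
  rw [H'.self] at ha
  obtain ⟨j, v, hv, rfl⟩ := mem_iUnion.1 ha
  refine ⟨j, fun u hu x hx hxs => ?_⟩
  have h1 : dist (TT (lam' j) (rot' j) (z' j) v) (TT (lam' j) (rot' j) (z' j) u) ≤ ε / 4 := by
    rw [TT_dist _ (H'.pos j)]
    have h2 : dist v u ≤ diam J := dist_le_diam_of_mem hJ.isBounded hv hu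
    have h3 : lam' j ≤ r ^ k := (h' j).trans (pow_le_pow_of_le_one hr0.le hr.le (by omega))
    rw [lt_div_iff₀ (by positivity)] at hk
    calc _ ≤ r ^ k * (diam J + 1) := by
          have := dist_nonneg (x := v) (y := u)
          gcongr
          linarith
      _ ≤ _ := hk.le
  have h2 := inner_lip hn (TT (lam' j) (rot' j) (z' j) v) x
  have h3 := dist_triangle_right (TT (lam' j) (rot' j) (z' j) v) x (TT (lam' j) (rot' j) (z' j) u)
  have h4 : |inner ℝ n x - t| ≤ ε / 4 := hxs
  have h5 := abs_sub_le (inner ℝ n (TT (lam' j) (rot' j) (z' j) v)) (inner ℝ n x) t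
  linarith

lemma exists_dim {s : ℕ} (lam : Fin s → ℝ) (hlam : ∀ i, 0 < lam i ∧ lam i < 1) (hs : 1 ≤ s) :
    ∃ d : ℝ, ∑ i, lam i ^ d = 1 := by
  have hc : Continuous (fun d : ℝ => ∑ i, lam i ^ d) := by
    apply continuous_finset_sum
    intro i _
    exact Real.continuous_const_rpow (hlam i).1.ne'
  have ht : Filter.Tendsto (fun d : ℝ => ∑ i, lam i ^ d) Filter.atTop (nhds 0) := by
    have : (0:ℝ) = ∑ i : Fin s, 0 := by simp
    rw [this]
    apply tendsto_finset_sum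
    intro i _
    exact tendsto_rpow_atTop_of_base_lt_one _ (by linarith [(hlam i).1]) (hlam i).2
  obtain ⟨D, hD, hD0⟩ := ((ht.eventually_lt_const one_pos).and (Filter.eventually_ge_atTop 0)).exists
  have h0 : (1:ℝ) ≤ ∑ i, lam i ^ (0:ℝ) := by simpa using hs
  obtain ⟨d, _, hd⟩ := intermediate_value_Icc' hD0 hc.continuousOn ⟨hD.le, h0⟩
  exact ⟨d, hd⟩

lemma line_strip {ℓ : Set ℂ} (h : IsLine ℓ) : ∃ (n : ℂ) (t : ℝ), ‖n‖ = 1 ∧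
    ∀ ρ, 0 ≤ ρ → cthickening ρ ℓ ⊆ strip n t ρ := by
  obtain ⟨p, v, hv, rfl⟩ := h
  have hv' : ‖v‖ ≠ 0 := norm_ne_zero_iff.2 hv
  set n : ℂ := ‖v‖⁻¹ • (Complex.I * v) with hndef
  have hn : ‖n‖ = 1 := by
    rw [hndef, norm_smul, norm_mul, Complex.norm_I, norm_inv, norm_norm]
    field_simp
  have hnv : inner ℝ n v = 0 := by
    rw [hndef, real_inner_smul_left, Complex.inner]
    simp
    right; ring
  refine ⟨n, inner ℝ n p, hn, fun ρ hρ x hx => ?_⟩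
  have hne : {w : ℂ | ∃ t : ℝ, w = p + t • v}.Nonempty := ⟨p, 0, by simp⟩
  have h1 : infDist x {w : ℂ | ∃ t : ℝ, w = p + t • v} ≤ ρ := by
    exact ENNReal.toReal_le_of_le_ofReal hρ hx
  refine le_trans ?_ h1
  rw [le_infDist hne]
  rintro _ ⟨t, rfl⟩
  have := inner_lip hn x (p + t • v)
  rwa [inner_add_right, inner_smul_right, hnv, mul_zero, add_zero] at this

end SS

end

theorem stmt16 (s : ℕ) (T : Fin s → ℂ → ℂ) (lam : Fin s → ℝ)
    (rot : Fin s → ℂ ≃ₗᵢ[ℝ] ℂ) (z : Fin s → ℂ)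
    (hlam : ∀ i, 0 < lam i ∧ lam i < 1)
    (hT : ∀ i x, T i x = lam i • (rot i x) + z i)
    (J : Set ℂ) (hJc : IsCompact J) (hJne : J.Nonempty)
    (hself : J = ⋃ i, T i '' J)
    (hOSC : ∃ Op : Set ℂ, IsOpen Op ∧ Op.Nonempty ∧ (⋃ i, T i '' Op) ⊆ Op ∧
      ∀ i j, i ≠ j → Disjoint (T i '' Op) (T j '' Op))
    (hline : ¬ Collinear ℝ J) :
    ∃ κ C : ℝ, 0 < κ ∧ 1 ≤ C ∧
      ∀ (ℓ : Set ℂ) (δ ρ : ℝ), IsLine ℓ → 0 < δ → δ < ρ → ρ ≤ 1 →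
        (volume (cthickening δ J ∩ cthickening ρ ℓ)).toReal ≤
          C * ρ ^ κ * (volume (cthickening δ J)).toReal := by
  have hT' : ∀ i, T i = SS.TT (lam i) (rot i) (z i) := fun i => funext (hT i)
  simp only [hT'] at hself hOSC
  have hs : 1 ≤ s := by
    rcases Nat.eq_zero_or_pos s with h | h
    · subst h
      simp only [iUnion_of_empty] at hself
      exact absurd hself hJne.ne_empty
    · exact h
  obtain ⟨d, hd⟩ := SS.exists_dim lam hlam hs
  have H : SS.IFS (Fin s) lam rot z J d := ⟨fun i => (hlam i).1, fun i => (hlam i).2, hself, hd⟩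
  obtain ⟨U, hU, hUne, hsub, hdis⟩ := hOSC
  obtain ⟨c, hc, hlow⟩ := SS.lower_V hJc hJne H U hU hUne (iUnion_subset_iff.1 hsub) hdis
  obtain ⟨κ, C, hκ, hC, hup⟩ := SS.upper_all hJc hJne hline H
  refine ⟨κ, max (C / c) 1, hκ, le_max_right _ _, ?_⟩
  intro ℓ δ ρ hℓ hδ hδρ hρ
  obtain ⟨n, t, hn, hsl⟩ := SS.line_strip hℓ
  have hρ0 : 0 < ρ := hδ.trans hδρ
  have h1 := hup ρ hρ0 hρ δ n t hδ hδρ.le hn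
  have h2 := hlow δ hδ (by linarith)
  have h3 : volume.real (cthickening δ J ∩ cthickening ρ ℓ) ≤
      volume.real (cthickening δ J ∩ SS.strip n t ρ) :=
    measureReal_mono (inter_subset_inter_right _ (hsl ρ hρ0.le))
      ((measure_mono inter_subset_left).trans_lt (SS.cth_fin hJc δ).lt_top).ne
  have h4 : 0 < ρ ^ κ := Real.rpow_pos_of_pos hρ0 _
  have h5 : 0 ≤ volume.real (cthickening δ J) := measureReal_nonneg
  calc volume.real (cthickening δ J ∩ cthickening ρ ℓ) ≤ C * δ ^ (2 - d) * ρ ^ κ := h3.trans h1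
    _ = C / c * ρ ^ κ * (c * δ ^ (2 - d)) := by field_simp
    _ ≤ C / c * ρ ^ κ * volume.real (cthickening δ J) := by gcongr
    _ ≤ max (C / c) 1 * ρ ^ κ * volume.real (cthickening δ J) := by
      gcongr
      exact le_max_left _ _
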